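/- arXiv:0909.5088 — 2 statements merged into one kernel-verified Lean document; each statement's English description precedes it below -/
import Mathlib

section
/- Let F be a finite field with q elements and n ≥ 0. Then w_n^n = q^{n(n+1)} · c_n − ∑_{k=0}^{n−1} G_q(k,n) · q^{(n−k)(n+2k)} · c_{n−k} · w_k^k, where w_m^j = #Y_m^j − #Z_m^j, G_q(k,n) is the number of k-dimensional F-subspaces of Fⁿ, and c_m is the number of pairs (B,C) ∈ M_m(F)² with BC = CB. -/
open Matrix

variable (F : Type*) [Field F] [Fintype F]

/-- The `(A,B,C)`-span of `v`: the smallest subspace of `Fⁿ` containing `v` and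
invariant under `A`, `B` and `C`. -/
def abcSpan {n : ℕ} (A B C : Matrix (Fin n) (Fin n) F) (v : Fin n → F) :
    Submodule F (Fin n → F) :=
  sInf {W | v ∈ W ∧ (∀ w ∈ W, A.mulVec w ∈ W) ∧ (∀ w ∈ W, B.mulVec w ∈ W) ∧
    (∀ w ∈ W, C.mulVec w ∈ W)}

/-- `#Y_n^k`: the number of tuples `(A,B,C,v) ∈ M_n(F)³ × Fⁿ` with `tr(A(BC−CB)) = 0`
whose `(A,B,C)`-span of `v` has dimension `k`. -/
noncomputable def Ycard (n k : ℕ) : ℕ :=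
  Nat.card {p : Matrix (Fin n) (Fin n) F × Matrix (Fin n) (Fin n) F ×
    Matrix (Fin n) (Fin n) F × (Fin n → F) //
    Matrix.trace (p.1 * (p.2.1 * p.2.2.1 - p.2.2.1 * p.2.1)) = 0 ∧
    Module.finrank F (abcSpan F p.1 p.2.1 p.2.2.1 p.2.2.2) = k}

/-- `#Z_n^k`: the number of tuples `(A,B,C,v) ∈ M_n(F)³ × Fⁿ` with `tr(A(BC−CB)) = 1`
whose `(A,B,C)`-span of `v` has dimension `k`. -/
noncomputable def Zcard (n k : ℕ) : ℕ :=
  Nat.card {p : Matrix (Fin n) (Fin n) F × Matrix (Fin n) (Fin n) F ×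
    Matrix (Fin n) (Fin n) F × (Fin n → F) //
    Matrix.trace (p.1 * (p.2.1 * p.2.2.1 - p.2.2.1 * p.2.1)) = 1 ∧
    Module.finrank F (abcSpan F p.1 p.2.1 p.2.2.1 p.2.2.2) = k}

/-- `w_n^k = #Y_n^k − #Z_n^k`. -/
noncomputable def w (n k : ℕ) : ℤ := (Ycard F n k : ℤ) - (Zcard F n k : ℤ)

/-- `c_m`: the number of commuting pairs of `m×m` matrices over `F`. -/
noncomputable def ccount (m : ℕ) : ℕ :=
  Nat.card {p : Matrix (Fin m) (Fin m) F × Matrix (Fin m) (Fin m) F //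
    p.1 * p.2 = p.2 * p.1}

/-- `G_q(k,n)`: the number of `k`-dimensional subspaces of `Fⁿ`. -/
noncomputable def grassCard (k n : ℕ) : ℕ :=
  Nat.card {W : Submodule F (Fin n → F) // Module.finrank F W = k}

/-- The subspaces containing `v` and invariant under `A`, `B`, `C`. -/
def invSubs {ι : Type*} [Fintype ι] (A B C : Matrix ι ι F) (v : ι → F) :
    Set (Submodule F (ι → F)) :=
  {W | v ∈ W ∧ (∀ w ∈ W, A.mulVec w ∈ W) ∧ (∀ w ∈ W, B.mulVec w ∈ W) ∧
    (∀ w ∈ W, C.mulVec w ∈ W)}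

/-- `W` is the smallest subspace containing `v` and invariant under `A`, `B`, `C`. -/
def IsSpan {ι : Type*} [Fintype ι] (A B C : Matrix ι ι F) (v : ι → F)
    (W : Submodule F (ι → F)) : Prop :=
  IsLeast (invSubs F A B C v) W

theorem isSpan_abcSpan {n : ℕ} (A B C : Matrix (Fin n) (Fin n) F) (v : Fin n → F) :
    IsSpan F A B C v (abcSpan F A B C v) := by
  refine ⟨?_, fun W hW => sInf_le hW⟩
  simp only [invSubs, abcSpan, Set.mem_ofPred_eq, Submodule.mem_sInf]
  exact ⟨fun W hW => hW.1, fun w hw W hW => hW.2.1 w (hw W hW),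
    fun w hw W hW => hW.2.2.1 w (hw W hW), fun w hw W hW => hW.2.2.2 w (hw W hW)⟩

theorem abcSpan_eq_iff {n : ℕ} (A B C : Matrix (Fin n) (Fin n) F) (v : Fin n → F)
    (W : Submodule F (Fin n → F)) : abcSpan F A B C v = W ↔ IsSpan F A B C v W :=
  ⟨fun h => h ▸ isSpan_abcSpan F A B C v, fun h => (isSpan_abcSpan F A B C v).unique h⟩

variable {F} in
open Classical in
/-- The weight `[t = 0] - [t = 1]`. -/
noncomputable def chi (t : F) : ℤ := (if t = 0 then 1 else 0) - (if t = 1 then 1 else 0)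

theorem card_matrix (ι κ : Type*) [Fintype ι] [DecidableEq ι] [Fintype κ] [DecidableEq κ] :
    Fintype.card (Matrix ι κ F) = Fintype.card F ^ (Fintype.card ι * Fintype.card κ) := by
  rw [mul_comm, pow_mul, ← Fintype.card_fun, ← Fintype.card_fun]
  rfl

open Classical in
theorem sum_chi_trace {ι : Type*} [Fintype ι] [DecidableEq ι] (D : Matrix ι ι F) (c : F) :
    ∑ A : Matrix ι ι F, chi (c + (A * D).trace) =
      if D = 0 then (Fintype.card F : ℤ) ^ (Fintype.card ι * Fintype.card ι) * chi c else 0 := by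
  split_ifs with h
  · subst h
    simp [card_matrix]
  · obtain ⟨i, j, hij⟩ : ∃ i j, D i j ≠ 0 := by
      by_contra! h'
      exact h (Matrix.ext h')
    set A₀ : Matrix ι ι F := Matrix.single j i (D i j)⁻¹
    have h₀ : (A₀ * D).trace = 1 := by
      simp [A₀, Matrix.trace_single_mul, hij]
    unfold chi
    rw [Finset.sum_sub_distrib, sub_eq_zero, ← (Equiv.subRight A₀).sum_comp]
    refine Finset.sum_congr rfl fun A _ => ?_
    have : c + ((A - A₀) * D).trace = c + (A * D).trace - 1 := by
      rw [sub_mul, Matrix.trace_sub, h₀]; ring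
    simp only [Equiv.subRight_apply, this, sub_eq_zero]

/-- Quadruples `(A, B, C, v)`. -/
abbrev Quad (ι : Type*) :=
  Matrix ι ι F × Matrix ι ι F × Matrix ι ι F × (ι → F)

variable {F} in
/-- The potential `tr(A(BC - CB))`. -/
def pot {ι : Type*} [Fintype ι] (A B C : Matrix ι ι F) : F :=
  (A * (B * C - C * B)).trace

open Classical in
/-- The weighted count of quadruples whose span is `W`. -/
noncomputable def wsum (ι : Type*) [Fintype ι] [DecidableEq ι] (W : Submodule F (ι → F)) : ℤ :=
  ∑ p : Quad F ι, if IsSpan F p.1 p.2.1 p.2.2.1 p.2.2.2 W then chi (pot p.1 p.2.1 p.2.2.1) else 0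

open Classical in
theorem w_eq_sum (n k : ℕ) :
    w F n k = ∑ p : Quad F (Fin n),
      if Module.finrank F (abcSpan F p.1 p.2.1 p.2.2.1 p.2.2.2) = k
      then chi (pot p.1 p.2.1 p.2.2.1) else 0 := by
  simp only [w, Ycard, Zcard, Nat.card_eq_fintype_card, Fintype.card_subtype, Finset.card_filter]
  push_cast
  rw [← Finset.sum_sub_distrib]
  refine Finset.sum_congr rfl fun p _ => ?_
  simp only [chi, pot, ite_and]
  split_ifs <;> simp_all

open Classical in
theorem w_self (n : ℕ) : w F n n = wsum F (Fin n) ⊤ := by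
  rw [w_eq_sum, wsum]
  refine Finset.sum_congr rfl fun p _ => ?_
  have : Module.finrank F (abcSpan F p.1 p.2.1 p.2.2.1 p.2.2.2) = n ↔
      IsSpan F p.1 p.2.1 p.2.2.1 p.2.2.2 ⊤ := by
    rw [← abcSpan_eq_iff]
    constructor
    · intro h
      exact Submodule.eq_top_of_finrank_eq (by simpa using h)
    · intro h
      rw [h]; simp
  exact if_congr this rfl rfl

open Classical in
theorem w_eq_sum_wsum (n k : ℕ) :
    w F n k = ∑ W : {W : Submodule F (Fin n → F) // Module.finrank F W = k},
      wsum F (Fin n) W := by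
  simp only [w_eq_sum, wsum]
  rw [Finset.sum_comm]
  refine Finset.sum_congr rfl fun p _ => ?_
  simp only [← abcSpan_eq_iff]
  split_ifs with h
  · rw [Finset.sum_eq_single ⟨_, h⟩]
    · simp
    · intro b _ hb
      rw [if_neg]
      rintro h'
      exact hb (Subtype.ext h'.symm)
    · simp
  · symm
    refine Finset.sum_eq_zero fun W _ => if_neg ?_
    intro h'
    exact h (h' ▸ W.2)

theorem sum_chi_pot (c : F) (m : ℕ) :
    ∑ p : Matrix (Fin m) (Fin m) F × Matrix (Fin m) (Fin m) F × Matrix (Fin m) (Fin m) F,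
      chi (c + pot p.1 p.2.1 p.2.2) = (Fintype.card F : ℤ) ^ (m * m) * ccount F m * chi c := by
  classical
  rw [Fintype.sum_prod_type, Finset.sum_comm]
  simp only [pot, sum_chi_trace, Fintype.card_fin, sub_eq_zero]
  rw [← Finset.sum_filter, Finset.sum_const, ccount, Nat.card_eq_fintype_card,
    Fintype.card_subtype, nsmul_eq_mul]
  ring

theorem sum_w (n : ℕ) :
    ∑ k ∈ Finset.range (n + 1), w F n k =
      (Fintype.card F : ℤ) ^ (n * (n + 1)) * ccount F n := by
  classical
  simp only [w_eq_sum]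
  rw [Finset.sum_comm]
  have h : ∀ p : Quad F (Fin n), (∑ k ∈ Finset.range (n + 1),
      if Module.finrank F (abcSpan F p.1 p.2.1 p.2.2.1 p.2.2.2) = k
      then chi (pot p.1 p.2.1 p.2.2.1) else 0) = chi (pot p.1 p.2.1 p.2.2.1) := by
    intro p
    rw [Finset.sum_ite_eq, if_pos]
    rw [Finset.mem_range, Nat.lt_succ_iff]
    simpa using Submodule.finrank_le (abcSpan F p.1 p.2.1 p.2.2.1 p.2.2.2)
  simp only [h]
  have h₂ := sum_chi_pot F 0 n
  simp only [Fintype.sum_prod_type, zero_add] at h₂ ⊢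
  simp only [Finset.sum_const, ← Finset.smul_sum, h₂]
  simp [chi]
  ring

theorem wsum_map {ι κ : Type*} [Fintype ι] [DecidableEq ι] [Fintype κ] [DecidableEq κ]
    (P : (ι → F) ≃ₗ[F] (κ → F)) (W : Submodule F (ι → F)) :
    wsum F ι W = wsum F κ (W.map P.toLinearMap) := by
  classical
  let φ : Matrix ι ι F ≃ Matrix κ κ F :=
    (Matrix.toLin'.trans (P.conj.trans LinearMap.toMatrix')).toEquiv
  have hφ : ∀ A, φ A = LinearMap.toMatrix' (P.conj (Matrix.toLin' A)) := fun A => rfl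
  have hmul : ∀ A B, φ (A * B) = φ A * φ B := by
    intro A B
    simp only [hφ, Matrix.toLin'_mul, LinearEquiv.conj_comp, LinearMap.toMatrix'_comp]
  have hsub : ∀ A B, φ (A - B) = φ A - φ B := by
    intro A B
    simp only [hφ, map_sub]
  have htr : ∀ A, (φ A).trace = A.trace := by
    intro A
    rw [← Matrix.trace_toLin'_eq, hφ, Matrix.toLin'_toMatrix', LinearMap.trace_conj',
      Matrix.trace_toLin'_eq]
  have hvec : ∀ A x, (φ A).mulVec (P x) = P (A.mulVec x) := by
    intro A x
    rw [hφ, LinearMap.toMatrix'_mulVec, LinearEquiv.conj_apply_apply]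
    simp
  have hinv : ∀ A B C v U, U ∈ invSubs F A B C v ↔
      U.map P.toLinearMap ∈ invSubs F (φ A) (φ B) (φ C) (P v) := by
    intro A B C v U
    have hD : ∀ D : Matrix ι ι F, (∀ w ∈ U.map P.toLinearMap,
        (φ D).mulVec w ∈ U.map P.toLinearMap) ↔ ∀ w ∈ U, D.mulVec w ∈ U := by
      intro D
      have hm : ∀ x, P x ∈ U.map P.toLinearMap ↔ x ∈ U := fun x => by simp
      rw [P.surjective.forall]
      simp only [hvec, hm]
    simp only [invSubs, Set.mem_ofPred_eq, hD]
    simp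
  refine Fintype.sum_equiv
    (φ.prodCongr (φ.prodCongr (φ.prodCongr P.toEquiv))) _ _ ?_
  rintro ⟨A, B, C, v⟩
  have hs : IsSpan F A B C v W ↔
      IsSpan F (φ A) (φ B) (φ C) (P v) (W.map P.toLinearMap) := by
    refine and_congr (hinv ..) ⟨fun h U hU => ?_, fun h U hU => ?_⟩
    · have hU' : (U.comap P.toLinearMap).map P.toLinearMap = U :=
        Submodule.map_comap_eq_of_surjective P.surjective U
      rw [← hU'] at hU ⊢
      exact Submodule.map_mono (h ((hinv ..).2 hU))
    · exact (Submodule.map_le_map_iff_of_injective P.injective _ _).1 (h ((hinv ..).1 hU))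
  have hp : pot (φ A) (φ B) (φ C) = pot A B C := by
    simp only [pot, ← hmul, ← hsub, htr]
  change (if IsSpan F A B C v W then chi (pot A B C) else 0) =
    if IsSpan F (φ A) (φ B) (φ C) (P v) (W.map P.toLinearMap) then
      chi (pot (φ A) (φ B) (φ C)) else 0
  simp only [hs, hp]

/-- Extension of vectors by zero. -/
def extZero (κ μ : Type*) : (κ → F) →ₗ[F] (κ ⊕ μ → F) where
  toFun x := Sum.elim x 0
  map_add' x y := by ext (i | i) <;> simp
  map_smul' a x := by ext (i | i) <;> simp

theorem exists_equiv_map_eq_range_extZero {n k : ℕ} (W : Submodule F (Fin n → F))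
    (hW : Module.finrank F W = k) :
    ∃ P : (Fin n → F) ≃ₗ[F] (Fin k ⊕ Fin (n - k) → F),
      W.map P.toLinearMap = LinearMap.range (extZero F (Fin k) (Fin (n - k))) := by
  obtain ⟨U, hU⟩ := Submodule.exists_isCompl W
  have hd := Submodule.finrank_add_eq_of_isCompl hU
  rw [Module.finrank_fin_fun] at hd
  have eW : W ≃ₗ[F] (Fin k → F) := LinearEquiv.ofFinrankEq _ _ (by simpa using hW)
  have eU : U ≃ₗ[F] (Fin (n - k) → F) := LinearEquiv.ofFinrankEq _ _ (by simp; omega)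
  let P := (Submodule.prodEquivOfIsCompl W U hU).symm ≪≫ₗ (eW.prodCongr eU) ≪≫ₗ
    (LinearEquiv.sumArrowLequivProdArrow (Fin k) (Fin (n - k)) F F).symm
  have hP : ∀ x : W, P x = extZero F _ _ (eW x) := by
    intro x
    ext (i | i) <;> simp [P, extZero]
  refine ⟨P, le_antisymm ?_ ?_⟩
  · rintro _ ⟨x, hx, rfl⟩
    exact ⟨eW ⟨x, hx⟩, (hP ⟨x, hx⟩).symm⟩
  · rintro _ ⟨y, rfl⟩
    exact ⟨eW.symm y, (eW.symm y).2, by simpa using hP (eW.symm y)⟩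

theorem fromBlocks_mulVec_extZero {κ μ : Type*} [Fintype κ] [Fintype μ]
    (A₁ : Matrix κ κ F) (A₂ : Matrix κ μ F) (A₃ : Matrix μ κ F) (A₄ : Matrix μ μ F) (x : κ → F) :
    (Matrix.fromBlocks A₁ A₂ A₃ A₄).mulVec (extZero F κ μ x) =
      Sum.elim (A₁.mulVec x) (A₃.mulVec x) := by
  ext (i | i) <;> simp [extZero, Matrix.fromBlocks_mulVec]

theorem sumElim_mem_range_extZero {κ μ : Type*} (x : κ → F) (y : μ → F) :
    Sum.elim x y ∈ LinearMap.range (extZero F κ μ) ↔ y = 0 := by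
  constructor
  · rintro ⟨z, hz⟩
    ext i
    simpa [extZero] using (congrFun hz (Sum.inr i)).symm
  · rintro rfl
    exact ⟨x, rfl⟩

theorem forall_fromBlocks_mulVec_mem_range_iff {κ μ : Type*} [Fintype κ] [Fintype μ]
    [DecidableEq κ] (A₁ : Matrix κ κ F) (A₂ : Matrix κ μ F) (A₃ : Matrix μ κ F)
    (A₄ : Matrix μ μ F) :
    (∀ w ∈ LinearMap.range (extZero F κ μ),
      (Matrix.fromBlocks A₁ A₂ A₃ A₄).mulVec w ∈ LinearMap.range (extZero F κ μ)) ↔ A₃ = 0 := by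
  simp only [LinearMap.mem_range, forall_exists_index, forall_apply_eq_imp_iff]
  simp only [← LinearMap.mem_range, fromBlocks_mulVec_extZero, sumElim_mem_range_extZero]
  constructor
  · intro h
    exact Matrix.ext_of_mulVec_single fun i => by rw [h, Matrix.zero_mulVec]
  · rintro rfl
    simp

theorem isSpan_range_extZero_iff {κ μ : Type*} [Fintype κ] [Fintype μ] [DecidableEq κ]
    (A₁ B₁ C₁ : Matrix κ κ F) (A₂ B₂ C₂ : Matrix κ μ F) (A₃ B₃ C₃ : Matrix μ κ F)
    (A₄ B₄ C₄ : Matrix μ μ F) (v₁ : κ → F) (v₂ : μ → F) :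
    IsSpan F (Matrix.fromBlocks A₁ A₂ A₃ A₄) (Matrix.fromBlocks B₁ B₂ B₃ B₄)
      (Matrix.fromBlocks C₁ C₂ C₃ C₄) (Sum.elim v₁ v₂) (LinearMap.range (extZero F κ μ)) ↔
    (v₂ = 0 ∧ A₃ = 0 ∧ B₃ = 0 ∧ C₃ = 0) ∧ IsSpan F A₁ B₁ C₁ v₁ ⊤ := by
  have hmem : LinearMap.range (extZero F κ μ) ∈ invSubs F (Matrix.fromBlocks A₁ A₂ A₃ A₄)
      (Matrix.fromBlocks B₁ B₂ B₃ B₄) (Matrix.fromBlocks C₁ C₂ C₃ C₄) (Sum.elim v₁ v₂) ↔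
      v₂ = 0 ∧ A₃ = 0 ∧ B₃ = 0 ∧ C₃ = 0 := by
    simp only [invSubs, Set.mem_ofPred_eq, forall_fromBlocks_mulVec_mem_range_iff,
      sumElim_mem_range_extZero]
  rw [IsSpan, IsLeast, hmem]
  refine and_congr_right ?_
  rintro ⟨rfl, rfl, rfl, rfl⟩
  have hvec : ∀ (D₁ : Matrix κ κ F) (D₂ : Matrix κ μ F) (D₄ : Matrix μ μ F) (x : κ → F),
      (Matrix.fromBlocks D₁ D₂ 0 D₄).mulVec (extZero F κ μ x) = extZero F κ μ (D₁.mulVec x) := by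
    intro D₁ D₂ D₄ x
    rw [fromBlocks_mulVec_extZero, Matrix.zero_mulVec]
    rfl
  have hv : Sum.elim v₁ (0 : μ → F) = extZero F κ μ v₁ := rfl
  have hinj : Function.Injective (extZero F κ μ) := fun x y h => by
    ext i
    exact congrFun h (Sum.inl i)
  rw [hv]
  constructor
  · intro h
    refine ⟨by simp [invSubs], fun U hU => ?_⟩
    have h' : U.map (extZero F κ μ) ∈ invSubs F (Matrix.fromBlocks A₁ A₂ 0 A₄)
        (Matrix.fromBlocks B₁ B₂ 0 B₄) (Matrix.fromBlocks C₁ C₂ 0 C₄) (extZero F κ μ v₁) := by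
      refine ⟨⟨v₁, hU.1, rfl⟩, ?_, ?_, ?_⟩
      · rintro _ ⟨x, hx, rfl⟩
        exact ⟨_, hU.2.1 x hx, (hvec ..).symm⟩
      · rintro _ ⟨x, hx, rfl⟩
        exact ⟨_, hU.2.2.1 x hx, (hvec ..).symm⟩
      · rintro _ ⟨x, hx, rfl⟩
        exact ⟨_, hU.2.2.2 x hx, (hvec ..).symm⟩
    intro x _
    obtain ⟨y, hy, hxy⟩ := h h' ⟨x, rfl⟩
    exact hinj hxy ▸ hy
  · rintro ⟨-, h⟩ U hU
    have h' : U.comap (extZero F κ μ) ∈ invSubs F A₁ B₁ C₁ v₁ := by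
      refine ⟨hU.1, fun x hx => ?_, fun x hx => ?_, fun x hx => ?_⟩
      · simpa only [Submodule.mem_comap, hvec] using hU.2.1 _ hx
      · simpa only [Submodule.mem_comap, hvec] using hU.2.2.1 _ hx
      · simpa only [Submodule.mem_comap, hvec] using hU.2.2.2 _ hx
    rintro _ ⟨x, rfl⟩
    exact h h' (Submodule.mem_top (x := x))

theorem pot_fromBlocks {κ μ : Type*} [Fintype κ] [Fintype μ]
    (A₁ B₁ C₁ : Matrix κ κ F) (A₂ B₂ C₂ : Matrix κ μ F) (A₄ B₄ C₄ : Matrix μ μ F) :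
    pot (Matrix.fromBlocks A₁ A₂ 0 A₄) (Matrix.fromBlocks B₁ B₂ 0 B₄)
      (Matrix.fromBlocks C₁ C₂ 0 C₄) = pot A₁ B₁ C₁ + pot A₄ B₄ C₄ := by
  simp [pot, Matrix.fromBlocks_multiply, sub_eq_add_neg, Matrix.fromBlocks_neg,
    Matrix.fromBlocks_add, Matrix.trace, Fintype.sum_sum_type]

/-- Block decomposition of quadruples. -/
def quadBlocks (κ μ : Type*) :
    (((μ → F) × Matrix μ κ F × Matrix μ κ F × Matrix μ κ F) ×
      (Matrix κ μ F × Matrix κ μ F × Matrix κ μ F) × Quad F κ ×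
      (Matrix μ μ F × Matrix μ μ F × Matrix μ μ F)) ≃ Quad F (κ ⊕ μ) where
  toFun p :=
    (Matrix.fromBlocks p.2.2.1.1 p.2.1.1 p.1.2.1 p.2.2.2.1,
      Matrix.fromBlocks p.2.2.1.2.1 p.2.1.2.1 p.1.2.2.1 p.2.2.2.2.1,
      Matrix.fromBlocks p.2.2.1.2.2.1 p.2.1.2.2 p.1.2.2.2 p.2.2.2.2.2,
      Sum.elim p.2.2.1.2.2.2 p.1.1)
  invFun p :=
    ((p.2.2.2 ∘ Sum.inr, p.1.toBlocks₂₁, p.2.1.toBlocks₂₁, p.2.2.1.toBlocks₂₁),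
      (p.1.toBlocks₁₂, p.2.1.toBlocks₁₂, p.2.2.1.toBlocks₁₂),
      (p.1.toBlocks₁₁, p.2.1.toBlocks₁₁, p.2.2.1.toBlocks₁₁, p.2.2.2 ∘ Sum.inl),
      (p.1.toBlocks₂₂, p.2.1.toBlocks₂₂, p.2.2.1.toBlocks₂₂))
  left_inv p := rfl
  right_inv p := by simp [Matrix.fromBlocks_toBlocks]

theorem quadBlocks_apply {κ μ : Type*}
    (A₁ B₁ C₁ : Matrix κ κ F) (A₂ B₂ C₂ : Matrix κ μ F) (A₃ B₃ C₃ : Matrix μ κ F)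
    (A₄ B₄ C₄ : Matrix μ μ F) (v₁ : κ → F) (v₂ : μ → F) :
    quadBlocks F κ μ ((v₂, A₃, B₃, C₃), (A₂, B₂, C₂), (A₁, B₁, C₁, v₁), (A₄, B₄, C₄)) =
      (Matrix.fromBlocks A₁ A₂ A₃ A₄, Matrix.fromBlocks B₁ B₂ B₃ B₄,
        Matrix.fromBlocks C₁ C₂ C₃ C₄, Sum.elim v₁ v₂) :=
  rfl

theorem wsum_range_extZero (k m : ℕ) :
    wsum F (Fin k ⊕ Fin m) (LinearMap.range (extZero F (Fin k) (Fin m))) =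
      (Fintype.card F : ℤ) ^ (3 * (k * m) + m * m) * ccount F m * wsum F (Fin k) ⊤ := by
  classical
  rw [wsum, ← (quadBlocks F (Fin k) (Fin m)).sum_comp, Fintype.sum_prod_type,
    Finset.sum_eq_single (0, 0, 0, 0)]
  · rw [Fintype.sum_prod_type]
    have h : ∀ (y : Matrix (Fin k) (Fin m) F × Matrix (Fin k) (Fin m) F × Matrix (Fin k) (Fin m) F)
        (z : Quad F (Fin k) × (Matrix (Fin m) (Fin m) F × Matrix (Fin m) (Fin m) F ×
          Matrix (Fin m) (Fin m) F)),
        (if IsSpan F (quadBlocks F (Fin k) (Fin m) ((0, 0, 0, 0), y, z)).1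
            (quadBlocks F (Fin k) (Fin m) ((0, 0, 0, 0), y, z)).2.1
            (quadBlocks F (Fin k) (Fin m) ((0, 0, 0, 0), y, z)).2.2.1
            (quadBlocks F (Fin k) (Fin m) ((0, 0, 0, 0), y, z)).2.2.2
            (LinearMap.range (extZero F (Fin k) (Fin m))) then
          chi (pot (quadBlocks F (Fin k) (Fin m) ((0, 0, 0, 0), y, z)).1
            (quadBlocks F (Fin k) (Fin m) ((0, 0, 0, 0), y, z)).2.1
            (quadBlocks F (Fin k) (Fin m) ((0, 0, 0, 0), y, z)).2.2.1) else 0) =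
        if IsSpan F z.1.1 z.1.2.1 z.1.2.2.1 z.1.2.2.2 ⊤ then
          chi (pot z.1.1 z.1.2.1 z.1.2.2.1 + pot z.2.1 z.2.2.1 z.2.2.2) else 0 := by
      rintro ⟨A₂, B₂, C₂⟩ ⟨⟨A₁, B₁, C₁, v₁⟩, A₄, B₄, C₄⟩
      simp only [quadBlocks_apply, isSpan_range_extZero_iff, pot_fromBlocks, true_and, and_self]
    simp only [h]
    rw [Finset.sum_const, Fintype.sum_prod_type, wsum, nsmul_eq_mul]
    have h₂ : ∀ x : Quad F (Fin k), (∑ z : Matrix (Fin m) (Fin m) F × Matrix (Fin m) (Fin m) F ×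
          Matrix (Fin m) (Fin m) F,
        if IsSpan F x.1 x.2.1 x.2.2.1 x.2.2.2 ⊤ then
          chi (pot x.1 x.2.1 x.2.2.1 + pot z.1 z.2.1 z.2.2) else 0) =
        (Fintype.card F : ℤ) ^ (m * m) * ccount F m *
        if IsSpan F x.1 x.2.1 x.2.2.1 x.2.2.2 ⊤ then chi (pot x.1 x.2.1 x.2.2.1) else 0 := by
      intro x
      split_ifs
      · exact sum_chi_pot ..
      · simp
    simp only [h₂, ← Finset.mul_sum]
    rw [Finset.card_univ, Fintype.card_prod, Fintype.card_prod, card_matrix]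
    simp only [Fintype.card_fin]
    push_cast
    ring
  · rintro ⟨v, a, b, c⟩ _ hr
    refine Finset.sum_eq_zero ?_
    rintro ⟨⟨A₂, B₂, C₂⟩, ⟨A₁, B₁, C₁, v₁⟩, A₄, B₄, C₄⟩ _
    refine if_neg fun h => hr ?_
    simp only [quadBlocks_apply, isSpan_range_extZero_iff] at h
    obtain ⟨⟨rfl, rfl, rfl, rfl⟩, -⟩ := h
    rfl
  · simp

theorem w_eq_of_le {n k : ℕ} (hk : k ≤ n) :
    w F n k = (grassCard F k n : ℤ) * (Fintype.card F : ℤ) ^ ((n - k) * (n + 2 * k)) *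
      (ccount F (n - k) : ℤ) * w F k k := by
  classical
  obtain ⟨m, rfl⟩ := Nat.exists_eq_add_of_le hk
  have h : ∀ W : {W : Submodule F (Fin (k + m) → F) // Module.finrank F W = k},
      wsum F (Fin (k + m)) W = (Fintype.card F : ℤ) ^ (m * (k + m + 2 * k)) *
        ccount F m * w F k k := by
    rintro ⟨W, hW⟩
    obtain ⟨P, hP⟩ := exists_equiv_map_eq_range_extZero F W hW
    rw [wsum_map F P, hP, wsum_range_extZero, w_self, Nat.add_sub_cancel_left]
    congr 3
    ring
  rw [w_eq_sum_wsum, Finset.sum_congr rfl fun W _ => h W, Finset.sum_const, grassCard,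
    Nat.card_eq_fintype_card, Nat.add_sub_cancel_left, nsmul_eq_mul, Finset.card_univ]
  ring

/-- the recursion
`w_n^n = q^{n(n+1)} c_n − ∑_{k=0}^{n−1} G_q(k,n) q^{(n−k)(n+2k)} c_{n−k} w_k^k`. -/
theorem statement_11 (q : ℕ) (hq : Fintype.card F = q) (n : ℕ) :
    w F n n = (q : ℤ) ^ (n * (n + 1)) * (ccount F n : ℤ) -
      ∑ k ∈ Finset.range n,
        (grassCard F k n : ℤ) * (q : ℤ) ^ ((n - k) * (n + 2 * k)) *
          (ccount F (n - k) : ℤ) * w F k k := by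
  subst hq
  rw [← sum_w, Finset.sum_range_succ, eq_sub_iff_add_eq, add_comm]
  congr 1
  exact Finset.sum_congr rfl fun k hk => (w_eq_of_le F (Finset.mem_range.1 hk).le).symm
end

section
/- Let F be a finite field with q elements and let 0 ≤ k ≤ n. Then q^{n−k} · #Y_n^k = q^{3k(n−k)} · G_q(k,n) · ( #Y_k^k · #Y_{n−k} + (q−1) · #Z_k^k · #Z_{n−k} ), where G_q(k,n) is the number of k-dimensional F-subspaces of Fⁿ. -/
open Matrix

variable (F : Type*) [Field F] [Fintype F]

/-- `#Y_m`: the number of tuples `(A,B,C,v) ∈ M_m(F)³ × Fᵐ` with `tr(A(BC−CB)) = 0`. -/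
noncomputable def YcardAll (m : ℕ) : ℕ :=
  Nat.card {p : Matrix (Fin m) (Fin m) F × Matrix (Fin m) (Fin m) F ×
    Matrix (Fin m) (Fin m) F × (Fin m → F) //
    Matrix.trace (p.1 * (p.2.1 * p.2.2.1 - p.2.2.1 * p.2.1)) = 0}

/-- `#Z_m`: the number of tuples `(A,B,C,v) ∈ M_m(F)³ × Fᵐ` with `tr(A(BC−CB)) = 1`. -/
noncomputable def ZcardAll (m : ℕ) : ℕ :=
  Nat.card {p : Matrix (Fin m) (Fin m) F × Matrix (Fin m) (Fin m) F ×
    Matrix (Fin m) (Fin m) F × (Fin m → F) //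
    Matrix.trace (p.1 * (p.2.1 * p.2.2.1 - p.2.2.1 * p.2.1)) = 1}

section Tuples

variable {K : Type*} [Field K] {ι κ : Type*}

/-- Extension of a vector by zero to a disjoint union of index types. -/
def inlExt (K ι κ : Type*) [Field K] : (ι → K) →ₗ[K] (ι ⊕ κ → K) where
  toFun x := Sum.elim x 0
  map_add' x y := by ext (i | i) <;> simp
  map_smul' c x := by ext (i | i) <;> simp

theorem inlExt_injective : Function.Injective (inlExt K ι κ) := fun x y h => by
  ext i; exact congrFun h (Sum.inl i)

theorem mem_range_inlExt {x : ι ⊕ κ → K} :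
    x ∈ LinearMap.range (inlExt K ι κ) ↔ x ∘ Sum.inr = 0 := by
  constructor
  · rintro ⟨y, rfl⟩; rfl
  · intro h
    refine ⟨x ∘ Sum.inl, ?_⟩
    change Sum.elim (x ∘ Sum.inl) 0 = x
    rw [← h, Sum.elim_comp_inl_inr]

variable [Fintype ι] [Fintype κ]

/-- Triples of square matrices together with a vector. -/
abbrev Tuple (K ι : Type*) : Type _ :=
  Matrix ι ι K × Matrix ι ι K × Matrix ι ι K × (ι → K)

/-- The potential `tr(A(BC−CB))` of a tuple `(A,B,C,v)`. -/
def Tuple.potential (p : Tuple K ι) : K :=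
  Matrix.trace (p.1 * (p.2.1 * p.2.2.1 - p.2.2.1 * p.2.1))

/-- A subspace contains `v` and is invariant under `A`, `B`, `C`. -/
def Tuple.Stable (p : Tuple K ι) (W : Submodule K (ι → K)) : Prop :=
  p.2.2.2 ∈ W ∧ (∀ w ∈ W, p.1.mulVec w ∈ W) ∧ (∀ w ∈ W, p.2.1.mulVec w ∈ W) ∧
    (∀ w ∈ W, p.2.2.1.mulVec w ∈ W)

/-- The smallest subspace containing `v` and invariant under `A`, `B`, `C`. -/
def Tuple.span (p : Tuple K ι) : Submodule K (ι → K) :=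
  sInf {W | p.Stable W}

theorem Tuple.span_le {p : Tuple K ι} {W : Submodule K (ι → K)} (h : p.Stable W) :
    p.span ≤ W :=
  sInf_le h

theorem Tuple.stable_span (p : Tuple K ι) : p.Stable p.span := by
  simp only [Tuple.Stable, Tuple.span, Submodule.mem_sInf, Set.mem_ofPred_eq]
  exact ⟨fun W h => h.1, fun w hw W h => h.2.1 w (hw W h),
    fun w hw W h => h.2.2.1 w (hw W h), fun w hw W h => h.2.2.2 w (hw W h)⟩

/-- Intertwining by a linear map transports the span. -/
theorem Tuple.span_map (e : (ι → K) →ₗ[K] (κ → K))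
    (p : Tuple K ι) (r : Tuple K κ)
    (hA : ∀ x, r.1.mulVec (e x) = e (p.1.mulVec x))
    (hB : ∀ x, r.2.1.mulVec (e x) = e (p.2.1.mulVec x))
    (hC : ∀ x, r.2.2.1.mulVec (e x) = e (p.2.2.1.mulVec x))
    (hv : r.2.2.2 = e p.2.2.2) :
    r.span = p.span.map e := by
  apply le_antisymm
  · obtain ⟨h1, h2, h3, h4⟩ := p.stable_span
    refine Tuple.span_le ⟨?_, ?_, ?_, ?_⟩
    · rw [hv]; exact Submodule.mem_map_of_mem h1
    · rintro _ ⟨x, hx, rfl⟩; rw [hA]; exact Submodule.mem_map_of_mem (h2 x hx)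
    · rintro _ ⟨x, hx, rfl⟩; rw [hB]; exact Submodule.mem_map_of_mem (h3 x hx)
    · rintro _ ⟨x, hx, rfl⟩; rw [hC]; exact Submodule.mem_map_of_mem (h4 x hx)
  · obtain ⟨h1, h2, h3, h4⟩ := r.stable_span
    rw [Submodule.map_le_iff_le_comap]
    refine Tuple.span_le ⟨?_, ?_, ?_, ?_⟩
    · rw [Submodule.mem_comap, ← hv]; exact h1
    · intro x hx; rw [Submodule.mem_comap, ← hA]; exact h2 _ hx
    · intro x hx; rw [Submodule.mem_comap, ← hB]; exact h3 _ hx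
    · intro x hx; rw [Submodule.mem_comap, ← hC]; exact h4 _ hx

section Conj

variable [DecidableEq ι] [DecidableEq κ]

/-- Change of coordinates on matrices. -/
def matrixConj (e : (ι → K) ≃ₗ[K] (κ → K)) : Matrix ι ι K ≃ₐ[K] Matrix κ κ K :=
  (Matrix.toLinAlgEquiv'.trans (e.conjAlgEquiv K)).trans LinearMap.toMatrixAlgEquiv'

theorem matrixConj_mulVec (e : (ι → K) ≃ₗ[K] (κ → K)) (A : Matrix ι ι K) (x : ι → K) :
    (matrixConj e A).mulVec (e x) = e (A.mulVec x) := by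
  rw [← Matrix.toLinAlgEquiv'_apply]
  simp [matrixConj]

theorem trace_matrixConj (e : (ι → K) ≃ₗ[K] (κ → K)) (A : Matrix ι ι K) :
    (matrixConj e A).trace = A.trace := by
  have h : matrixConj e A = LinearMap.toMatrix' (e.conj (Matrix.toLin' A)) := rfl
  rw [h, ← LinearMap.toMatrix_eq_toMatrix', ← LinearMap.trace_eq_matrix_trace,
    LinearMap.trace_conj', Matrix.trace_toLin'_eq]

/-- Change of coordinates on tuples. -/
def tupleConj (e : (ι → K) ≃ₗ[K] (κ → K)) : Tuple K ι ≃ Tuple K κ :=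
  (matrixConj e).toEquiv.prodCongr ((matrixConj e).toEquiv.prodCongr
    ((matrixConj e).toEquiv.prodCongr e.toEquiv))

theorem potential_tupleConj (e : (ι → K) ≃ₗ[K] (κ → K)) (p : Tuple K ι) :
    (tupleConj e p).potential = p.potential := by
  rw [Tuple.potential, Tuple.potential, ← trace_matrixConj e]
  simp [tupleConj]

theorem span_tupleConj (e : (ι → K) ≃ₗ[K] (κ → K)) (p : Tuple K ι) :
    (tupleConj e p).span = p.span.map e.toLinearMap :=
  Tuple.span_map e.toLinearMap p _ (matrixConj_mulVec e _) (matrixConj_mulVec e _)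
    (matrixConj_mulVec e _) rfl

/-- Change of coordinates on tuples with prescribed potential and span. -/
def fiberConj (e : (ι → K) ≃ₗ[K] (κ → K)) (t : K) (W : Submodule K (ι → K))
    (W' : Submodule K (κ → K)) (hW : W.map e.toLinearMap = W') :
    {p : Tuple K ι // p.potential = t ∧ p.span = W} ≃
      {p : Tuple K κ // p.potential = t ∧ p.span = W'} :=
  (tupleConj e).subtypeEquiv fun p => by
    rw [potential_tupleConj, span_tupleConj, ← hW,
      (Submodule.map_injective_of_injective e.injective).eq_iff]

end Conj

theorem toBlocks₂₁_eq_zero_of_invariant [DecidableEq ι] (A : Matrix (ι ⊕ κ) (ι ⊕ κ) K)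
    (h : ∀ x ∈ LinearMap.range (inlExt K ι κ), A.mulVec x ∈ LinearMap.range (inlExt K ι κ)) :
    A.toBlocks₂₁ = 0 := by
  ext i j
  have := mem_range_inlExt.1 (h _ ⟨Pi.single j 1, rfl⟩)
  have h2 := congrFun this i
  simpa [inlExt, Matrix.mulVec, dotProduct, Pi.single_apply, toBlocks₂₁] using h2

theorem exists_equiv_map_eq_range_inlExt {n k : ℕ} (W : Submodule K (Fin n → K))
    (hW : Module.finrank K W = k) :
    ∃ e : (Fin n → K) ≃ₗ[K] (Fin k ⊕ Fin (n - k) → K),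
      W.map e.toLinearMap = LinearMap.range (inlExt K (Fin k) (Fin (n - k))) := by
  obtain ⟨W', h⟩ := Submodule.exists_isCompl W
  have hs := Submodule.finrank_add_eq_of_isCompl h
  rw [Module.finrank_fin_fun] at hs
  have e1 : W ≃ₗ[K] (Fin k → K) := LinearEquiv.ofFinrankEq _ _ (by simp [hW])
  have e2 : W' ≃ₗ[K] (Fin (n - k) → K) := LinearEquiv.ofFinrankEq _ _ (by simp; omega)
  let e := (Submodule.prodEquivOfIsCompl W W' h).symm.trans
    ((e1.prodCongr e2).trans (LinearEquiv.sumArrowLequivProdArrow (Fin k) (Fin (n - k)) K K).symm)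
  refine ⟨e, ?_⟩
  have key : ∀ x : Fin n → K, e x ∈ LinearMap.range (inlExt K (Fin k) (Fin (n - k))) ↔ x ∈ W := by
    intro x
    rw [mem_range_inlExt]
    have : (e x) ∘ Sum.inr = e2 ((Submodule.prodEquivOfIsCompl W W' h).symm x).2 := rfl
    rw [this, LinearEquiv.map_eq_zero_iff, Submodule.prodEquivOfIsCompl_symm_apply_snd_eq_zero]
  ext y
  obtain ⟨x, rfl⟩ := e.surjective y
  rw [key]
  simp

/-- Assemble a block upper triangular tuple. -/
def blockTuple (x : Matrix ι κ K × Matrix ι κ K × Matrix ι κ K) (p : Tuple K ι)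
    (r : Tuple K κ) : Tuple K (ι ⊕ κ) :=
  (fromBlocks p.1 x.1 0 r.1, fromBlocks p.2.1 x.2.1 0 r.2.1,
    fromBlocks p.2.2.1 x.2.2 0 r.2.2.1, Sum.elim p.2.2.2 0)

theorem potential_blockTuple (x : Matrix ι κ K × Matrix ι κ K × Matrix ι κ K) (p : Tuple K ι)
    (r : Tuple K κ) : (blockTuple x p r).potential = p.potential + r.potential := by
  simp [Tuple.potential, blockTuple, fromBlocks_multiply, sub_eq_add_neg, fromBlocks_neg,
    fromBlocks_add, Matrix.trace]

theorem span_blockTuple (x : Matrix ι κ K × Matrix ι κ K × Matrix ι κ K) (p : Tuple K ι)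
    (r : Tuple K κ) : (blockTuple x p r).span = p.span.map (inlExt K ι κ) := by
  apply Tuple.span_map <;> try intro y
  all_goals simp [blockTuple, inlExt, fromBlocks_mulVec]

theorem span_blockTuple_eq_range_iff (x : Matrix ι κ K × Matrix ι κ K × Matrix ι κ K)
    (p : Tuple K ι) (r : Tuple K κ) :
    (blockTuple x p r).span = LinearMap.range (inlExt K ι κ) ↔ p.span = ⊤ := by
  rw [span_blockTuple, LinearMap.range_eq_map,
    (Submodule.map_injective_of_injective inlExt_injective).eq_iff]

theorem eq_blockTuple [DecidableEq ι] (p : Tuple K (ι ⊕ κ))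
    (h : p.span = LinearMap.range (inlExt K ι κ)) (u : κ → K) :
    p = blockTuple (p.1.toBlocks₁₂, p.2.1.toBlocks₁₂, p.2.2.1.toBlocks₁₂)
      (p.1.toBlocks₁₁, p.2.1.toBlocks₁₁, p.2.2.1.toBlocks₁₁, p.2.2.2 ∘ Sum.inl)
      (p.1.toBlocks₂₂, p.2.1.toBlocks₂₂, p.2.2.1.toBlocks₂₂, u) := by
  obtain ⟨h1, h2, h3, h4⟩ := h ▸ p.stable_span
  obtain ⟨A, B, C, v⟩ := p
  have hA := toBlocks₂₁_eq_zero_of_invariant A h2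
  have hB := toBlocks₂₁_eq_zero_of_invariant B h3
  have hC := toBlocks₂₁_eq_zero_of_invariant C h4
  have hv := mem_range_inlExt.1 h1
  simp only [blockTuple, Prod.mk.injEq]
  refine ⟨?_, ?_, ?_, ?_⟩
  · rw [← hA, fromBlocks_toBlocks]
  · rw [← hB, fromBlocks_toBlocks]
  · rw [← hC, fromBlocks_toBlocks]
  · rw [← hv, Sum.elim_comp_inl_inr]

/-- Block decomposition of the tuples whose span is the first coordinate subspace; the spare vector
in `κ → K` completes the lower right blocks to a tuple. -/
def blockEquiv [DecidableEq ι] (t : K) :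
    {p : Tuple K (ι ⊕ κ) // p.potential = t ∧ p.span = LinearMap.range (inlExt K ι κ)} × (κ → K) ≃
      (Matrix ι κ K × Matrix ι κ K × Matrix ι κ K) ×
        {s : Tuple K ι × Tuple K κ // s.1.potential + s.2.potential = t ∧ s.1.span = ⊤} where
  toFun p := ⟨(p.1.1.1.toBlocks₁₂, p.1.1.2.1.toBlocks₁₂, p.1.1.2.2.1.toBlocks₁₂),
    ⟨((p.1.1.1.toBlocks₁₁, p.1.1.2.1.toBlocks₁₁, p.1.1.2.2.1.toBlocks₁₁,
        p.1.1.2.2.2 ∘ Sum.inl),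
      (p.1.1.1.toBlocks₂₂, p.1.1.2.1.toBlocks₂₂, p.1.1.2.2.1.toBlocks₂₂, p.2)), by
      obtain ⟨⟨p, hp, hs⟩, u⟩ := p
      have he := eq_blockTuple p hs u
      rw [he, potential_blockTuple] at hp
      rw [he, span_blockTuple_eq_range_iff] at hs
      exact ⟨hp, hs⟩⟩⟩
  invFun s := ⟨⟨blockTuple s.1 s.2.1.1 s.2.1.2, by
    rw [potential_blockTuple, span_blockTuple_eq_range_iff]
    exact s.2.2⟩, s.2.1.2.2.2.2⟩
  left_inv p := by
    obtain ⟨⟨p, hp, hs⟩, u⟩ := p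
    exact Prod.ext (Subtype.ext (eq_blockTuple p hs u).symm) rfl
  right_inv s := by
    obtain ⟨⟨x, y, z⟩, ⟨⟨⟨A, B, C, v⟩, ⟨A', B', C', v'⟩⟩, hs⟩⟩ := s
    simp [blockTuple]

/-- Pairs of tuples with total potential zero, sorted by the potential of the first one. -/
def pairEquiv :
    {s : Tuple K ι × Tuple K κ // s.1.potential + s.2.potential = 0 ∧ s.1.span = ⊤} ≃
      Σ c : K, {p : Tuple K ι // p.potential = c ∧ p.span = ⊤} ×
        {r : Tuple K κ // r.potential = -c} where
  toFun s := ⟨s.1.1.potential, ⟨s.1.1, rfl, s.2.2⟩, ⟨s.1.2, by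
    rw [eq_neg_iff_add_eq_zero, add_comm]; exact s.2.1⟩⟩
  invFun x := ⟨(x.2.1.1, x.2.2.1), by rw [x.2.1.2.1, x.2.2.2, add_neg_cancel], x.2.1.2.2⟩
  left_inv s := rfl
  right_inv x := by
    obtain ⟨c, ⟨p, rfl, hs⟩, ⟨r, hr⟩⟩ := x
    rfl

/-- Scaling the first matrix by a unit. -/
def scaleFirst (c : Kˣ) : Tuple K ι ≃ Tuple K ι :=
  (MulAction.toPerm c).prodCongr (Equiv.refl _)

theorem potential_scaleFirst (c : Kˣ) (p : Tuple K ι) :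
    (scaleFirst c p).potential = c * p.potential := by
  simp [scaleFirst, Tuple.potential, Units.smul_def]

theorem span_scaleFirst (c : Kˣ) (p : Tuple K ι) : (scaleFirst c p).span = p.span := by
  have h : ∀ W, (scaleFirst c p).Stable W ↔ p.Stable W := fun W => by
    simp only [Tuple.Stable, scaleFirst, Equiv.prodCongr_apply, Prod.map_fst, Prod.map_snd,
      Equiv.refl_apply, MulAction.toPerm_apply, Units.smul_def, smul_mulVec]
    simp only [Submodule.smul_mem_iff W c.ne_zero]
  simp only [Tuple.span, h]

/-- Tuples of nonzero potential `c` correspond to tuples of potential `1`. -/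
def scaleFirstEquiv (c : Kˣ) (P : Submodule K (ι → K) → Prop) :
    {p : Tuple K ι // p.potential = 1 ∧ P p.span} ≃
      {p : Tuple K ι // p.potential = c ∧ P p.span} :=
  (scaleFirst c).subtypeEquiv fun p => by
    rw [potential_scaleFirst, span_scaleFirst]
    simp

theorem card_potential_eq {c : K} (hc : c ≠ 0) :
    Nat.card {p : Tuple K ι // p.potential = c} = Nat.card {p : Tuple K ι // p.potential = 1} := by
  have := Nat.card_congr (scaleFirstEquiv (ι := ι) (Units.mk0 c hc) fun _ => True)
  simpa using this.symm

theorem card_potential_eq_and_span_eq_top {c : K} (hc : c ≠ 0) :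
    Nat.card {p : Tuple K ι // p.potential = c ∧ p.span = ⊤} =
      Nat.card {p : Tuple K ι // p.potential = 1 ∧ p.span = ⊤} :=
  (Nat.card_congr (scaleFirstEquiv (ι := ι) (Units.mk0 c hc) fun W => W = ⊤)).symm

theorem card_pairs [Fintype K] :
    (Nat.card {s : Tuple K ι × Tuple K κ //
        s.1.potential + s.2.potential = 0 ∧ s.1.span = ⊤} : ℤ) =
      Nat.card {p : Tuple K ι // p.potential = 0 ∧ p.span = ⊤} *
          Nat.card {r : Tuple K κ // r.potential = 0} +
        ((Fintype.card K : ℤ) - 1) * Nat.card {p : Tuple K ι // p.potential = 1 ∧ p.span = ⊤} *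
          Nat.card {r : Tuple K κ // r.potential = 1} := by
  classical
  rw [Nat.card_congr pairEquiv, Nat.card_sigma, ← Finset.add_sum_erase _ _ (Finset.mem_univ 0)]
  rw [Finset.sum_congr rfl (g := fun _ =>
    Nat.card {p : Tuple K ι // p.potential = 1 ∧ p.span = ⊤} *
      Nat.card {r : Tuple K κ // r.potential = 1})]
  · rw [Finset.sum_const, Finset.card_erase_of_mem (Finset.mem_univ _), Finset.card_univ,
      Nat.card_prod, neg_zero]
    rw [nsmul_eq_mul]
    push_cast [Nat.cast_pred (R := ℤ) (Fintype.card_pos (α := K))]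
    ring
  · intro c hc
    have hc := Finset.ne_of_mem_erase hc
    rw [Nat.card_prod, card_potential_eq (neg_ne_zero.2 hc), card_potential_eq_and_span_eq_top hc]

/-- Tuples whose span has dimension `k`, fibered over the subspaces of dimension `k`. -/
noncomputable def grassFibration (n k : ℕ) (t : K) :
    {p : Tuple K (Fin n) // p.potential = t ∧ Module.finrank K p.span = k} ≃
      {W : Submodule K (Fin n → K) // Module.finrank K W = k} ×
        {p : Tuple K (Fin k ⊕ Fin (n - k)) // p.potential = t ∧
          p.span = LinearMap.range (inlExt K (Fin k) (Fin (n - k)))} :=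
  calc
    _ ≃ Σ W : {W : Submodule K (Fin n → K) // Module.finrank K W = k},
        {p : Tuple K (Fin n) // p.potential = t ∧ p.span = W.1} :=
      { toFun := fun p => ⟨⟨p.1.span, p.2.2⟩, ⟨p.1, p.2.1, rfl⟩⟩
        invFun := fun x => ⟨x.2.1, x.2.2.1,
          (congrArg (fun W : Submodule K (Fin n → K) => Module.finrank K W) x.2.2.2).trans x.1.2⟩
        left_inv := fun p => rfl
        right_inv := fun x => by
          obtain ⟨⟨W, hW⟩, ⟨p, hp, hs⟩⟩ := x
          change p.span = W at hs
          subst hs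
          rfl }
    _ ≃ Σ _ : {W : Submodule K (Fin n → K) // Module.finrank K W = k}, _ :=
      Equiv.sigmaCongrRight fun W =>
        fiberConj (exists_equiv_map_eq_range_inlExt W.1 W.2).choose t W.1 _
          (exists_equiv_map_eq_range_inlExt W.1 W.2).choose_spec
    _ ≃ _ := Equiv.sigmaEquivProd _ _

theorem card_finrank_span_eq_self (k : ℕ) (t : K) :
    Nat.card {p : Tuple K (Fin k) // p.potential = t ∧ Module.finrank K p.span = k} =
      Nat.card {p : Tuple K (Fin k) // p.potential = t ∧ p.span = ⊤} := by
  refine Nat.card_congr (Equiv.subtypeEquivRight fun p => and_congr_right fun _ => ?_)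
  constructor
  · intro h
    exact Submodule.eq_top_of_finrank_eq (by rw [h, Module.finrank_fin_fun])
  · intro h
    rw [h, finrank_top, Module.finrank_fin_fun]

end Tuples

/-- `q^{n−k} #Y_n^k = q^{3k(n−k)} G_q(k,n) (#Y_k^k · #Y_{n−k} + (q−1) #Z_k^k · #Z_{n−k})`. -/
theorem statement_12 (q : ℕ) (hq : Fintype.card F = q) (n k : ℕ) (hk : k ≤ n) :
    (q : ℤ) ^ (n - k) * (Ycard F n k : ℤ) =
      (q : ℤ) ^ (3 * k * (n - k)) * (grassCard F k n : ℤ) *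
        ((Ycard F k k : ℤ) * (YcardAll F (n - k) : ℤ) +
          ((q : ℤ) - 1) * (Zcard F k k : ℤ) * (ZcardAll F (n - k) : ℤ)) := by
  subst hq
  have hY : ∀ n k, Ycard F n k = Nat.card {p : Tuple F (Fin n) //
      p.potential = 0 ∧ Module.finrank F p.span = k} := fun _ _ => rfl
  have hZ : ∀ n k, Zcard F n k = Nat.card {p : Tuple F (Fin n) //
      p.potential = 1 ∧ Module.finrank F p.span = k} := fun _ _ => rfl
  have hYA : ∀ n, YcardAll F n = Nat.card {p : Tuple F (Fin n) // p.potential = 0} := fun _ => rfl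
  have hZA : ∀ n, ZcardAll F n = Nat.card {p : Tuple F (Fin n) // p.potential = 1} := fun _ => rfl
  have hblock := Nat.card_congr (blockEquiv (K := F) (ι := Fin k) (κ := Fin (n - k)) 0)
  have hfib : Ycard F n k = grassCard F k n * _ :=
    (Nat.card_congr (grassFibration n k (0 : F))).trans (Nat.card_prod _ _)
  have hvec : Nat.card (Fin (n - k) → F) = Fintype.card F ^ (n - k) := by
    simp [Nat.card_eq_fintype_card]
  have hmat : Nat.card (Matrix (Fin k) (Fin (n - k)) F) = Fintype.card F ^ (k * (n - k)) := by
    rw [show Nat.card (Matrix (Fin k) (Fin (n - k)) F) =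
      Nat.card (Fin k → Fin (n - k) → F) from rfl, Nat.card_fun, hvec, Nat.card_fin, ← pow_mul,
      mul_comm]
  rw [Nat.card_prod, Nat.card_prod, Nat.card_prod, Nat.card_prod, hvec, hmat] at hblock
  have hpairs := card_pairs (K := F) (ι := Fin k) (κ := Fin (n - k))
  rw [← card_finrank_span_eq_self, ← card_finrank_span_eq_self, ← hY, ← hZ, ← hYA, ← hZA]
    at hpairs
  rw [← hpairs, hfib]
  zify at hblock
  push_cast
  rw [mul_left_comm, mul_comm _ (Nat.card _ : ℤ), hblock]
  ring
end
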